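/- (Deformed affine Cartan determinant of type A^{(2)}_{2ℓ}.) Let ℓ ≥ 2 be an integer and let s, σ be nonzero complex numbers. Define the (ℓ+1)×(ℓ+1) complex matrix Ĉ = (C_{i,j})_{i,j=0,…,ℓ} by: C_{0,0} = σ² s⁻¹ + σ^{−2} s; C_{i,i} = s + s⁻¹ for 1 ≤ i ≤ ℓ−1; C_{ℓ,ℓ} = s σ + s⁻¹ σ⁻¹; C_{0,1} = −1; C_{1,0} = −(σ² + σ^{−2}); C_{i,i+1} = C_{i+1,i} = −1 for 1 ≤ i ≤ ℓ−2; C_{ℓ−1,ℓ} = −1; C_{ℓ,ℓ−1} = −(σ + σ⁻¹); all other entries 0. Then det Ĉ = (s − s⁻¹)(s^{ℓ} σ⁻¹ − s^{−ℓ} σ). -/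

import Mathlib

/-- The `n × n` tridiagonal matrix with diagonal `a`, superdiagonal `b` and subdiagonal `c`. -/
def tridiagonal {R : Type*} [Zero R] (a b c : ℕ → R) (n : ℕ) : Matrix (Fin n) (Fin n) R :=
  Matrix.of fun i j =>
    if i.val = j.val then a i
    else if i.val + 1 = j.val then b i
    else if j.val + 1 = i.val then c j
    else 0

/-- The continuant recurrence for determinants of tridiagonal matrices. -/
theorem det_tridiagonal_succ_succ {R : Type*} [CommRing R] (a b c : ℕ → R) (n : ℕ) :
    (tridiagonal a b c (n + 2)).det =
      a (n + 1) * (tridiagonal a b c (n + 1)).det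
        - b n * c n * (tridiagonal a b c n).det := by
  have hlast : (tridiagonal a b c (n + 2)).submatrix
      (Fin.last (n + 1)).succAbove (Fin.last (n + 1)).succAbove = tridiagonal a b c (n + 1) := by
    ext i j
    simp [tridiagonal]
  have hminor : ((tridiagonal a b c (n + 2)).submatrix
      (Fin.last n).castSucc.succAbove (Fin.last (n + 1)).succAbove).det =
        c n * (tridiagonal a b c n).det := by
    rw [Matrix.det_succ_row _ (Fin.last n), Fin.sum_univ_castSucc, Finset.sum_eq_zero]
    · have hsub : ((tridiagonal a b c (n + 2)).submatrix
          (Fin.last n).castSucc.succAbove (Fin.last (n + 1)).succAbove).submatrix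
          (Fin.last n).succAbove (Fin.last n).succAbove = tridiagonal a b c n := by
        ext i j
        simp [tridiagonal]
      rw [hsub]
      simp [tridiagonal, ← two_mul, show n + 1 + 1 ≠ n by omega]
    · intro j _
      have hj := j.isLt
      simp [tridiagonal, show n + 1 ≠ j.val by omega, show n + 2 ≠ j.val by omega,
        show j.val ≠ n by omega]
  rw [Matrix.det_succ_column _ (Fin.last (n + 1)), Fin.sum_univ_castSucc, Fin.sum_univ_castSucc,
    Finset.sum_eq_zero, hlast, hminor]
  · have hsign : (-1 : R) ^ (n + (n + 1)) = -1 := Odd.neg_one_pow ⟨n, by omega⟩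
    simp [tridiagonal, ← two_mul, hsign]
    ring
  · intro i _
    have hi := i.isLt
    simp [tridiagonal, show i.val ≠ n + 1 by omega, show n + 1 + 1 ≠ i.val by omega,
      show i.val ≠ n by omega]

/-- Principal minors of a tridiagonal matrix that starts with the affine end of
`A^{(2)}_{2ℓ}` and continues with constant diagonal `s + s⁻¹`. -/
theorem det_tridiagonal_affine_end {K : Type*} [Field K] {s t : K} (hs : s ≠ 0)
    {a b c : ℕ → K} {m : ℕ} (ha₀ : a 0 = t * s⁻¹ + t⁻¹ * s)
    (ha : ∀ k, 1 ≤ k → k ≤ m → a k = s + s⁻¹)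
    (hbc₀ : 1 ≤ m → b 0 * c 0 = t + t⁻¹) (hbc : ∀ k, 1 ≤ k → k < m → b k * c k = 1) :
    ∀ k ≤ m, (tridiagonal a b c (k + 1)).det = t * (s ^ (k + 1))⁻¹ + t⁻¹ * s ^ (k + 1) := by
  intro k
  induction k using Nat.twoStepInduction with
  | zero => intro _; simp [tridiagonal, ha₀]
  | one =>
    intro hm
    rw [det_tridiagonal_succ_succ, ha 1 le_rfl hm, hbc₀ hm]
    simp only [tridiagonal, Nat.reduceAdd, Matrix.det_unique, Matrix.det_isEmpty,
      Matrix.of_apply, Fin.default_eq_zero, Fin.val_zero, if_true, zero_add, ha₀]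
    field_simp
    ring
  | more k ih₀ ih₁ =>
    intro hm
    rw [det_tridiagonal_succ_succ, ih₀ (by omega), ih₁ (by omega),
      ha (k + 1 + 1) (by omega) hm, hbc (k + 1) (by omega) (by omega)]
    simp only [pow_succ, mul_inv]
    field_simp
    ring


/-- determinant of the deformed affine Cartan matrix of type A^{(2)}_{2ℓ}. -/
theorem det_deformed_cartan_A2even
    (ℓ : ℕ) (hℓ : 2 ≤ ℓ) (s σ : ℂ) (hs : s ≠ 0) (hσ : σ ≠ 0)
    (C : Matrix (Fin (ℓ + 1)) (Fin (ℓ + 1)) ℂ)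
    (hC : ∀ i j : Fin (ℓ + 1), C i j =
      if i = j then
        (if i.val = 0 then σ ^ 2 * s⁻¹ + (σ ^ 2)⁻¹ * s
         else if i.val = ℓ then s * σ + s⁻¹ * σ⁻¹
         else s + s⁻¹)
      else if i.val = 1 ∧ j.val = 0 then -(σ ^ 2 + (σ ^ 2)⁻¹)
      else if i.val = ℓ ∧ j.val + 1 = ℓ then -(σ + σ⁻¹)
      else if i.val + 1 = j.val ∨ j.val + 1 = i.val then -1
      else 0) :
    C.det = (s - s⁻¹) * (s ^ ℓ * σ⁻¹ - (s ^ ℓ)⁻¹ * σ) := by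
  obtain ⟨n, rfl⟩ : ∃ n, ℓ = n + 2 := ⟨ℓ - 2, by omega⟩
  let a : ℕ → ℂ := fun k =>
    if k = 0 then σ ^ 2 * s⁻¹ + (σ ^ 2)⁻¹ * s
    else if k = n + 2 then s * σ + s⁻¹ * σ⁻¹
    else s + s⁻¹
  let c : ℕ → ℂ := fun k =>
    if k = 0 then -(σ ^ 2 + (σ ^ 2)⁻¹) else if k = n + 1 then -(σ + σ⁻¹) else -1
  have hCT : C = tridiagonal a (fun _ => -1) c (n + 2 + 1) := by
    ext i j
    rw [hC]
    simp only [tridiagonal, Matrix.of_apply, a, c, Fin.ext_iff]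
    split_ifs <;> first | rfl | omega
  have hminor := det_tridiagonal_affine_end (m := n + 1) (t := σ ^ 2) (a := a)
    (b := fun _ => -1) (c := c) hs (by simp [a])
    (fun k h₁ h₂ => by simp [a, show k ≠ 0 by omega, show k ≠ n + 2 by omega])
    (fun _ => by simp [c])
    (fun k h₁ h₂ => by simp [c, show k ≠ 0 by omega, show k ≠ n + 1 by omega])
  have haLast : a (n + 1 + 1) = s * σ + s⁻¹ * σ⁻¹ := by simp [a]
  have hcLast : c (n + 1) = -(σ + σ⁻¹) := by simp [c]
  rw [hCT, det_tridiagonal_succ_succ, hminor (n + 1) le_rfl, hminor n (by omega), haLast, hcLast]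
  simp only [pow_succ, mul_inv]
  field_simp
  ring
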